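/- No order-based semantics is *-composable: for every suitable order ⪯ there exist a database D and a regular expression R such that (S_⪯(D,R))* is not a subset of S_⪯(D, R*). -/

import Mathlib

namespace RPQ

/-- Vertex identifiers. -/
abbrev V : Type := ℕ
/-- Edge identifiers. -/
abbrev Edg : Type := ℕ
/-- Labels. -/
abbrev Lab : Type := ℕ

/-- A walk: a nonempty alternating sequence `v₀,e₁,v₁,…,e_k,v_k`, encoded as the
initial vertex together with the list of (edge, next-vertex) pairs. -/
structure Walk where
  head : V
  steps : List (Edg × V)
deriving DecidableEq

namespace Walk

def length (w : Walk) : ℕ := w.steps.length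
def src (w : Walk) : V := w.head
def tgt (w : Walk) : V := (w.steps.map Prod.snd).getLastD w.head
/-- The pair of endpoints of a walk. -/
def ep (w : Walk) : V × V := (w.src, w.tgt)
def vertexList (w : Walk) : List V := w.head :: w.steps.map Prod.snd
def edgeList (w : Walk) : List Edg := w.steps.map Prod.fst
/-- Concatenation of walks (meaningful when `w.tgt = w'.src`). -/
def concat (w w' : Walk) : Walk := ⟨w.head, w.steps ++ w'.steps⟩

end Walk

/-- A graph database. -/
structure Database where
  labels : Finset Lab
  verts : Finset V
  edges : Finset Edg
  src : Edg → V
  tgt : Edg → V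
  lbl : Edg → Lab
  src_mem : ∀ e ∈ edges, src e ∈ verts
  tgt_mem : ∀ e ∈ edges, tgt e ∈ verts
  lbl_mem : ∀ e ∈ edges, lbl e ∈ labels

def chainFrom (D : Database) : V → List (Edg × V) → Prop
  | _, [] => True
  | v, (e, v') :: rest =>
      e ∈ D.edges ∧ D.src e = v ∧ D.tgt e = v' ∧ chainFrom D v' rest

/-- `w` is consistent with `D`, i.e. `w` is a walk in `D`. -/
def Walk.Consistent (D : Database) (w : Walk) : Prop :=
  w.head ∈ D.verts ∧ chainFrom D w.head w.steps

/-- The set of walks in `D`. -/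
def Walks (D : Database) : Set Walk := {w | w.Consistent D}

/-- The label of a walk in `D`: the word of its successive edge labels. -/
def Walk.label (D : Database) (w : Walk) : List Lab :=
  w.steps.map fun p => D.lbl p.1

abbrev RE := RegularExpression Lab

/-- Matches of `R` in `D`: walks in `D` whose label conforms to `R`. -/
def Matches (D : Database) (R : RE) : Set Walk :=
  {w | w.Consistent D ∧ w.label D ∈ R.matches'}

/-- A semantics maps a database and a query to a finite subset of its matches. -/
def IsSemantics (S : Database → RE → Set Walk) : Prop :=
  ∀ D R, S D R ⊆ Matches D R ∧ (S D R).Finite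

/-- `S` is walk-based. -/
def WalkBased (S : Database → RE → Set Walk) : Prop :=
  ∃ r : Set Walk → Set Walk, ∀ D R, S D R = r (Matches D R)

/-- The semantics defined by a filter `f`. -/
def FilterSem (f : Walk → Bool) (D : Database) (R : RE) : Set Walk :=
  {w ∈ Matches D R | f w = true}

/-- Componentwise inclusion of databases. -/
def Database.Sub (D D' : Database) : Prop :=
  D.labels ⊆ D'.labels ∧ D.verts ⊆ D'.verts ∧ D.edges ⊆ D'.edges ∧
    ∀ e ∈ D.edges, D'.src e = D.src e ∧ D'.tgt e = D.tgt e ∧ D'.lbl e = D.lbl e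

def IsPartialOrderRel (le : Walk → Walk → Prop) : Prop :=
  (∀ w, le w w) ∧ (∀ a b c, le a b → le b c → le a c) ∧ ∀ a b, le a b → le b a → a = b

/-- `le` is a well-partial-order on the walks of `D`. -/
def IsWpoOn (le : Walk → Walk → Prop) (D : Database) : Prop :=
  ∀ f : ℕ → Walk, (∀ n, (f n).Consistent D) → ∃ i j, i < j ∧ le (f i) (f j)

/-- Suitable order: a partial order on walks that is a wpo on `Walks D` for each `D`. -/
def Suitable (le : Walk → Walk → Prop) : Prop :=
  IsPartialOrderRel le ∧ ∀ D, IsWpoOn le D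

/-- The semantics based on the order `le`: the `le`-minimal matches among those
with the same endpoints. -/
def OrderSem (le : Walk → Walk → Prop) (D : Database) (R : RE) : Set Walk :=
  {w ∈ Matches D R | ∀ w' ∈ Matches D R, w'.ep = w.ep → le w' w → w' = w}

def Monotonous (S : Database → RE → Set Walk) : Prop :=
  ∀ D D' R, D.Sub D' → S D R ⊆ S D' R

def CoMonotonous (S : Database → RE → Set Walk) : Prop :=
  ∀ D D' R, D.Sub D' → S D' R ∩ Walks D ⊆ S D R

def Stabilizing (S : Database → RE → Set Walk) : Prop :=
  ∀ (D : Database) (Rs : ℕ → RE),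
    (∀ i j, i ≤ j → ∀ u, u ∈ (Rs i).matches' → u ∈ (Rs j).matches') →
    ∃ N, ∀ n, N ≤ n → S D (Rs n) = S D (Rs N)

/-- Concatenation lifted to sets of walks. -/
def setConcat (W W' : Set Walk) : Set Walk :=
  {u | ∃ w ∈ W, ∃ w' ∈ W', w.tgt = w'.src ∧ u = w.concat w'}

/-- `setStar W` : all concatenations `w₁·…·w_k` (k ≥ 1) of walks of `W`. -/
inductive setStar (W : Set Walk) : Walk → Prop
  | base : ∀ w ∈ W, setStar W w
  | step : ∀ u w, setStar W u → w ∈ W → u.tgt = w.src → setStar W (u.concat w)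

/-- Walks jointly consistent with some database. -/
def ConsistentPair (w w' : Walk) : Prop :=
  ∃ D : Database, w.Consistent D ∧ w'.Consistent D

/-- The trimming of an order. -/
def trimRel (le : Walk → Walk → Prop) (w w' : Walk) : Prop :=
  ConsistentPair w w' ∧ w.ep = w'.ep ∧ le w w'

def Trimmed (le : Walk → Walk → Prop) : Prop := trimRel le = le

/-- `le` respects element inclusion. -/
def RespectsElemIncl (le : Walk → Walk → Prop) : Prop :=
  ∀ w w', le w w' →
    (∀ v ∈ w.vertexList, v ∈ w'.vertexList) ∧ ∀ e ∈ w.edgeList, e ∈ w'.edgeList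

/-- Action of a relabeling on a database. -/
def Database.relabel (π : Equiv.Perm Lab) (D : Database) : Database where
  labels := D.labels.image (⇑π)
  verts := D.verts
  edges := D.edges
  src := D.src
  tgt := D.tgt
  lbl := fun e => π (D.lbl e)
  src_mem := D.src_mem
  tgt_mem := D.tgt_mem
  lbl_mem := fun e he => Finset.mem_image_of_mem (⇑π) (D.lbl_mem e he)

/-- Action of a renaming on a walk. -/
def Walk.rename (νv : Equiv.Perm V) (νe : Equiv.Perm Edg) (w : Walk) : Walk :=
  ⟨νv w.head, w.steps.map fun p => (νe p.1, νv p.2)⟩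

/-- Action of a renaming on a database. -/
def Database.rename (νv : Equiv.Perm V) (νe : Equiv.Perm Edg) (D : Database) :
    Database where
  labels := D.labels
  verts := D.verts.image (⇑νv)
  edges := D.edges.image (⇑νe)
  src := fun e => νv (D.src (νe.symm e))
  tgt := fun e => νv (D.tgt (νe.symm e))
  lbl := fun e => D.lbl (νe.symm e)
  src_mem := by
    intro e he
    obtain ⟨e', he', rfl⟩ := Finset.mem_image.mp he
    simpa using Finset.mem_image_of_mem (⇑νv) (D.src_mem e' he')
  tgt_mem := by
    intro e he
    obtain ⟨e', he', rfl⟩ := Finset.mem_image.mp he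
    simpa using Finset.mem_image_of_mem (⇑νv) (D.tgt_mem e' he')
  lbl_mem := by
    intro e he
    obtain ⟨e', he', rfl⟩ := Finset.mem_image.mp he
    simpa using D.lbl_mem e' he'

/-- Identifier independence. -/
def IdIndependent (S : Database → RE → Set Walk) : Prop :=
  ∀ (νv : Equiv.Perm V) (νe : Equiv.Perm Edg) (D : Database) (R : RE),
    Walk.rename νv νe '' S D R = S (Database.rename νv νe D) R

/-- Unbounded semantics. -/
def Unbounded (S : Database → RE → Set Walk) : Prop :=
  ∀ n : ℕ, ∃ (D : Database) (R : RE) (w : Walk), w ∈ S D R ∧ n ≤ w.length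

/-- Shortest-walk semantics. -/
def Sh (D : Database) (R : RE) : Set Walk :=
  {w ∈ Matches D R | ∀ w' ∈ Matches D R, w'.ep = w.ep → w.length ≤ w'.length}

/-- The factor-inserting relation `F`. -/
def FactorIns (w w' : Walk) : Prop :=
  ∃ w₁ w₂ w₃ : Walk, w₁.tgt = w₂.src ∧ w₂.tgt = w₃.src ∧ w₁.tgt = w₃.src ∧
    w = w₁.concat w₃ ∧ w' = (w₁.concat w₂).concat w₃

/-- The subwalk order: reflexive–transitive closure of `FactorIns`. -/
def SubwalkOrd : Walk → Walk → Prop := Relation.ReflTransGen FactorIns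

/-- The database with a single vertex carrying a single loop. -/
def loopDatabase : Database where
  labels := {0}
  verts := {0}
  edges := {0}
  src := fun _ => 0
  tgt := fun _ => 0
  lbl := fun _ => 0
  src_mem := by simp
  tgt_mem := by simp
  lbl_mem := by simp

/-- The walk going `n` times around the loop of `loopDatabase`. -/
def loopWalk (n : ℕ) : Walk := ⟨0, List.replicate n (0, 0)⟩

theorem loopWalk_injective : Function.Injective loopWalk := by
  intro m n h
  simpa [loopWalk] using h

theorem loopWalk_concat (m n : ℕ) :
    (loopWalk m).concat (loopWalk n) = loopWalk (m + n) := by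
  simp [loopWalk, Walk.concat]

theorem loopWalk_tgt (n : ℕ) : (loopWalk n).tgt = 0 := by
  cases n with
  | zero => rfl
  | succ n => simp [loopWalk, Walk.tgt, List.getLastD_eq_getLast?, List.getLast?_replicate]

theorem loopWalk_ep (n : ℕ) : (loopWalk n).ep = (0, 0) := by
  rw [Walk.ep, loopWalk_tgt]; rfl

theorem loopWalk_consistent (n : ℕ) : (loopWalk n).Consistent loopDatabase := by
  refine ⟨by simp [loopWalk, loopDatabase], ?_⟩
  induction n with
  | zero => trivial
  | succ n ih => exact ⟨by simp [loopDatabase], rfl, rfl, ih⟩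

theorem eq_loopWalk_of_consistent {w : Walk} (h : w.Consistent loopDatabase) :
    w = loopWalk w.length := by
  obtain ⟨v, l⟩ := w
  obtain ⟨hv, hl⟩ := h
  obtain rfl : v = 0 := by simpa [loopDatabase] using hv
  suffices l = List.replicate l.length (0, 0) from congrArg (Walk.mk 0) this
  clear hv
  change chainFrom loopDatabase 0 l at hl
  induction l with
  | nil => rfl
  | cons p l ih =>
    obtain ⟨e, v⟩ := p
    obtain ⟨he, -, rfl, hl⟩ := hl
    obtain rfl : e = 0 := by simpa [loopDatabase] using he
    exact congrArg (List.cons _) (ih hl)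

theorem loopWalk_mem_matches_star (n : ℕ) :
    loopWalk n ∈ Matches loopDatabase (RegularExpression.char 0).star := by
  refine ⟨loopWalk_consistent n, ?_⟩
  change _ ∈ KStar.kstar ({[0]} : Language Lab)
  refine Language.mem_kstar.2 ⟨List.replicate n [0], ?_, ?_⟩
  · simp [Walk.label, loopWalk, loopDatabase]
  · intro y hy
    exact List.eq_of_mem_replicate hy

theorem loopWalk_one_mem_orderSem (le : Walk → Walk → Prop) :
    loopWalk 1 ∈ OrderSem le loopDatabase (RegularExpression.char 0) := by
  refine ⟨⟨loopWalk_consistent 1, rfl⟩, ?_⟩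
  rintro w ⟨hw, hl⟩ - -
  have hlen : w.length = 1 := by
    have h : w.label loopDatabase = [0] := hl
    simpa [Walk.label, Walk.length] using congrArg List.length h
  rw [eq_loopWalk_of_consistent hw, hlen]

theorem setStar_loopWalk_succ (le : Walk → Walk → Prop) (n : ℕ) :
    setStar (OrderSem le loopDatabase (RegularExpression.char 0)) (loopWalk (n + 1)) := by
  induction n with
  | zero => exact .base _ (loopWalk_one_mem_orderSem le)
  | succ n ih =>
    rw [← loopWalk_concat (n + 1) 1]
    exact .step _ _ ih (loopWalk_one_mem_orderSem le) (loopWalk_tgt _)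

/-- No order-based semantics is *-composable. -/
theorem no_orderBased_starComposable
    (le : Walk → Walk → Prop) (hle : Suitable le) :
    ∃ (D : Database) (R : RE),
      ¬ ({w | setStar (OrderSem le D R) w} ⊆ OrderSem le D R.star) := by
  refine ⟨loopDatabase, RegularExpression.char 0, fun hsub => ?_⟩
  obtain ⟨i, j, hij, h⟩ :=
    hle.2 loopDatabase (fun n => loopWalk (n + 1)) fun n => loopWalk_consistent _
  have hmin := (hsub (setStar_loopWalk_succ le j)).2 _ (loopWalk_mem_matches_star (i + 1))
    (by rw [loopWalk_ep, loopWalk_ep]) h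
  have := loopWalk_injective hmin
  omega

end RPQ
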